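/- arXiv:2004.02265 — 2 statements merged into one kernel-verified Lean document; each statement's English description precedes it below -/
import Mathlib

section
/- For all t > 0, t' > 0, every z in ℚ_p, and every integer a, ∫_{B_a} ρ(t,x)·ρ(t', z−x) dμ(x) = p^a · ∫_{ℚ_p} χ(z·y)·exp(−σ·t'·|y|^b)·(∫_{B_{−a}} exp(−σ·t·|y+w|^b) dμ(w)) dμ(y); in particular the complex integral on the right-hand side is a real number. -/
open MeasureTheory

/-- The fundamental solution `ρ(t,x)` of the p-adic diffusion equation with diffusion
constant `σ` and Vladimirov exponent `b`:
`ρ(t,x) = Σ_{r∈ℤ} (exp(−σ t p^{rb}) − exp(−σ t p^{(r+1)b})) p^r 1_{B_{−r}}(x)`. -/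
noncomputable def rho (p : ℕ) [Fact p.Prime] (σ b : ℝ) (t : ℝ) (x : ℚ_[p]) : ℝ :=
  ∑' r : ℤ,
    (Real.exp (-(σ * t * (p : ℝ) ^ ((r : ℝ) * b))) -
      Real.exp (-(σ * t * (p : ℝ) ^ (((r : ℝ) + 1) * b)))) *
    (p : ℝ) ^ (r : ℤ) *
    Set.indicator {y : ℚ_[p] | ‖y‖ ≤ (p : ℝ) ^ (-r : ℤ)} (fun _ => 1) x

/-- The ball `B_r` of radius `p ^ r` around `0` in `ℚ_p`. -/
def padicBall (p : ℕ) [Fact p.Prime] (r : ℤ) : Set ℚ_[p] := {x | ‖x‖ ≤ (p : ℝ) ^ r}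

section Ball

variable {p : ℕ} [Fact p.Prime]

lemma prime_cast_pos : (0 : ℝ) < p := by exact_mod_cast (Fact.out : p.Prime).pos

lemma one_lt_prime_cast : (1 : ℝ) < p := by exact_mod_cast (Fact.out : p.Prime).one_lt

lemma mem_padicBall {r : ℤ} {x : ℚ_[p]} : x ∈ padicBall p r ↔ ‖x‖ ≤ (p : ℝ) ^ r := Iff.rfl

lemma padicBall_eq_closedBall (r : ℤ) :
    padicBall p r = Metric.closedBall (0 : ℚ_[p]) ((p : ℝ) ^ r) := by
  ext x; simp [mem_padicBall]

lemma isClopen_padicBall (r : ℤ) : IsClopen (padicBall p r) := by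
  rw [padicBall_eq_closedBall]
  exact IsUltrametricDist.isClopen_closedBall _ (zpow_pos prime_cast_pos r).ne'

lemma isCompact_padicBall (r : ℤ) : IsCompact (padicBall p r) := by
  rw [padicBall_eq_closedBall]
  exact isCompact_closedBall _ _

lemma add_mem_padicBall_iff {r : ℤ} {x y : ℚ_[p]} (hy : y ∈ padicBall p r) :
    x + y ∈ padicBall p r ↔ x ∈ padicBall p r := by
  have key : ∀ u v : ℚ_[p], u ∈ padicBall p r → v ∈ padicBall p r → u + v ∈ padicBall p r :=
    fun u v hu hv => (Padic.nonarchimedean u v).trans (max_le hu hv)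
  refine ⟨fun h => ?_, fun h => key _ _ h hy⟩
  have := key _ (-y) h (by simpa [mem_padicBall] using hy)
  simpa using this

lemma exists_nat_sub_mem_padicBall {r : ℤ} {x : ℚ_[p]} (hx : x ∈ padicBall p (r + 1)) :
    ∃ i < p, x - (i : ℚ_[p]) * (p : ℚ_[p]) ^ (-(r + 1)) ∈ padicBall p r := by
  have hp0 : (p : ℚ_[p]) ≠ 0 := by exact_mod_cast (Fact.out : p.Prime).ne_zero
  have hu : ‖x * (p : ℚ_[p]) ^ (r + 1)‖ ≤ 1 := by
    rw [norm_mul, Padic.norm_p_zpow, zpow_neg, ← div_eq_mul_inv]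
    exact div_le_one_of_le₀ hx (zpow_pos prime_cast_pos _).le
  set u : ℤ_[p] := ⟨_, hu⟩ with hudef
  refine ⟨u.zmodRepr, u.zmodRepr_lt_p, ?_⟩
  have h1 := u.sub_zmodRepr_mem
  rw [PadicInt.maximalIdeal_eq_span_p, ← pow_one (p : ℤ_[p]),
    ← PadicInt.norm_le_pow_iff_mem_span_pow] at h1
  have h2 : x - (u.zmodRepr : ℚ_[p]) * (p : ℚ_[p]) ^ (-(r + 1))
      = ((u - u.zmodRepr : ℤ_[p]) : ℚ_[p]) * (p : ℚ_[p]) ^ (-(r + 1)) := by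
    push_cast
    rw [hudef, sub_mul]
    simp only [mul_assoc]
    rw [← zpow_add₀ hp0]
    simp
  rw [mem_padicBall, h2, norm_mul, Padic.norm_p_zpow]
  calc _ ≤ (p : ℝ) ^ (-((1 : ℕ) : ℤ)) * (p : ℝ) ^ (- -(r + 1)) := by gcongr; exact h1
    _ = _ := by rw [← zpow_add₀ prime_cast_pos.ne']; congr 1; push_cast; ring

variable [MeasurableSpace ℚ_[p]] [BorelSpace ℚ_[p]] (μ : Measure ℚ_[p]) [μ.IsAddHaarMeasure]

lemma measure_padicBall_succ (r : ℤ) :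
    μ (padicBall p (r + 1)) = p * μ (padicBall p r) := by
  set c : ℚ_[p] := (p : ℚ_[p]) ^ (-(r + 1)) with hc
  have hcn : ‖c‖ = (p : ℝ) ^ (r + 1) := by rw [hc, Padic.norm_p_zpow, neg_neg]
  set A : ℕ → Set ℚ_[p] := fun i => (fun x => x + -(i * c)) ⁻¹' padicBall p r with hA
  have hlt : (p : ℝ) ^ r < (p : ℝ) ^ (r + 1) :=
    zpow_lt_zpow_right₀ one_lt_prime_cast (lt_add_one r)
  have hU : padicBall p (r + 1) = ⋃ i ∈ Finset.range p, A i := by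
    ext x
    simp only [Set.mem_iUnion, Finset.mem_range, exists_prop]
    constructor
    · intro hx
      obtain ⟨i, hi, h⟩ := exists_nat_sub_mem_padicBall hx
      exact ⟨i, hi, by rwa [sub_eq_add_neg] at h⟩
    · rintro ⟨i, -, h⟩
      have h' : ‖x + -((i : ℚ_[p]) * c)‖ ≤ (p : ℝ) ^ r := h
      refine (add_mem_padicBall_iff (y := -((i : ℚ_[p]) * c)) ?_).1 (h'.trans hlt.le)
      have : ‖(i : ℚ_[p])‖ ≤ 1 := by exact_mod_cast Padic.norm_int_le_one (p := p) (i : ℤ)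
      simp only [mem_padicBall, norm_neg, norm_mul, hcn]
      exact mul_le_of_le_one_left (zpow_pos prime_cast_pos _).le this
  have hdisj : Set.PairwiseDisjoint (↑(Finset.range p)) A := by
    intro i hi j hj hij
    rw [Function.onFun, Set.disjoint_left]
    intro x hx hy
    have h1 : x + -(i * c) ∈ padicBall p r := hx
    have h2 : -(x + -(j * c)) ∈ padicBall p r := by
      have : x + -(j * c) ∈ padicBall p r := hy
      simpa only [mem_padicBall, norm_neg] using this
    have h3 := (add_mem_padicBall_iff h2).2 h1
    have h4 : x + -(i * c) + -(x + -(j * c)) = (((j : ℤ) - (i : ℤ) : ℤ) : ℚ_[p]) * c := by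
      push_cast; ring
    rw [h4] at h3
    have h5 : ‖(((j : ℤ) - (i : ℤ) : ℤ) : ℚ_[p])‖ = 1 := by
      refine le_antisymm (Padic.norm_int_le_one _) (not_lt.1 fun h => hij ?_)
      rw [Padic.norm_intCast_lt_one_iff] at h
      simp only [Finset.coe_range, Set.mem_Iio] at hi hj
      have := Int.eq_zero_of_abs_lt_dvd h (by rw [abs_lt]; omega)
      omega
    simp only [mem_padicBall, norm_mul, h5, hcn, one_mul] at h3
    exact absurd h3 (not_le.2 hlt)
  rw [hU, measure_biUnion_finset hdisj]
  · simp [A, measure_preimage_add_right]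
  · intro i _
    exact (isClopen_padicBall r).isOpen.measurableSet.preimage (measurable_add_const _)

lemma measureReal_padicBall (hμ : μ (padicBall p 0) = 1) (r : ℤ) :
    μ.real (padicBall p r) = (p : ℝ) ^ r := by
  have hs : ∀ r : ℤ, μ.real (padicBall p (r + 1)) = p * μ.real (padicBall p r) := fun r => by
    simp [measureReal_def, measure_padicBall_succ μ r]
  have hp := (prime_cast_pos (p := p)).ne'
  induction r using Int.induction_on with
  | zero => simp only [measureReal_def, hμ]; simp
  | succ n ih => rw [hs, ih, zpow_add_one₀ hp, mul_comm]
  | pred n ih =>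
    have := hs (-n - 1)
    rw [sub_add_cancel, ih] at this
    rw [zpow_sub_one₀ hp, this]
    field_simp

end Ball

section Character

variable {p : ℕ} [Fact p.Prime]

/-- `r` represents the polar part of `x`: it lies in `ℤ[1/p]` and `x - r` is a `p`-adic integer. -/
def IsPolarPart (x : ℚ_[p]) (r : ℚ) : Prop :=
  (∃ (m : ℤ) (k : ℕ), r = (m : ℚ) / (p : ℚ) ^ k) ∧ ‖x - (r : ℚ_[p])‖ ≤ 1

lemma exists_isPolarPart (x : ℚ_[p]) : ∃ r, IsPolarPart x r := by
  have hp0 : (p : ℚ_[p]) ≠ 0 := by exact_mod_cast (Fact.out : p.Prime).ne_zero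
  obtain ⟨k, hk⟩ := pow_unbounded_of_one_lt ‖x‖ (one_lt_prime_cast (p := p))
  have hu : ‖x * (p : ℚ_[p]) ^ k‖ ≤ 1 := by
    rw [norm_mul, Padic.norm_p_pow, zpow_neg, ← div_eq_mul_inv, zpow_natCast]
    exact div_le_one_of_le₀ hk.le (pow_pos prime_cast_pos _).le
  set u : ℤ_[p] := ⟨_, hu⟩ with hudef
  have h1 := u.appr_spec k
  rw [← PadicInt.norm_le_pow_iff_mem_span_pow] at h1
  refine ⟨(u.appr k : ℤ) / (p : ℚ) ^ k, ⟨_, k, rfl⟩, ?_⟩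
  have h2 : x - (((u.appr k : ℤ) / (p : ℚ) ^ k : ℚ) : ℚ_[p])
      = ((u - u.appr k : ℤ_[p]) : ℚ_[p]) * (p : ℚ_[p]) ^ (-(k : ℤ)) := by
    push_cast
    rw [hudef, sub_mul, zpow_neg, zpow_natCast]
    field_simp
  rw [h2, norm_mul, Padic.norm_p_zpow, neg_neg]
  calc _ ≤ (p : ℝ) ^ (-(k : ℤ)) * (p : ℝ) ^ (k : ℤ) := by gcongr; exact h1
    _ = 1 := by rw [← zpow_add₀ prime_cast_pos.ne']; simp

lemma IsPolarPart.add {x y : ℚ_[p]} {r s : ℚ} (hx : IsPolarPart x r) (hy : IsPolarPart y s) :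
    IsPolarPart (x + y) (r + s) := by
  have hp0 : (p : ℚ) ≠ 0 := by exact_mod_cast (Fact.out : p.Prime).ne_zero
  obtain ⟨⟨m, k, rfl⟩, hx⟩ := hx
  obtain ⟨⟨n, l, rfl⟩, hy⟩ := hy
  refine ⟨⟨m * p ^ l + n * p ^ k, k + l, ?_⟩, ?_⟩
  · push_cast; rw [pow_add]; field_simp
  · rw [Rat.cast_add, add_sub_add_comm]
    exact (Padic.nonarchimedean _ _).trans (max_le hx hy)

lemma isPolarPart_intCast {x : ℚ_[p]} (hx : ‖x‖ ≤ 1) (n : ℤ) : IsPolarPart x n := by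
  refine ⟨⟨n, 0, by simp⟩, ?_⟩
  rw [Rat.cast_intCast, sub_eq_add_neg]
  refine (Padic.nonarchimedean _ _).trans (max_le hx ?_)
  rw [norm_neg]
  exact Padic.norm_int_le_one n

/-- `χ` is the rank-zero additive character `x ↦ exp (2πi{x})` of `ℚ_p`. -/
def IsStandardChar (χ : ℚ_[p] → ℂ) : Prop :=
  ∀ (x : ℚ_[p]) (r : ℚ), (∃ (m : ℤ) (k : ℕ), r = (m : ℚ) / (p : ℚ) ^ k) →
    0 ≤ r → r < 1 → ‖x - (r : ℚ_[p])‖ ≤ 1 →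
    χ x = Complex.exp (2 * Real.pi * Complex.I * (r : ℂ))

variable {χ : ℚ_[p] → ℂ}

lemma IsStandardChar.eq_exp (hχ : IsStandardChar χ) {x : ℚ_[p]} {r : ℚ} (h : IsPolarPart x r) :
    χ x = Complex.exp (2 * Real.pi * Complex.I * (r : ℂ)) := by
  have hf : IsPolarPart x (Int.fract r) := by
    have := h.add (isPolarPart_intCast (x := (0 : ℚ_[p])) (by simp) (-⌊r⌋))
    rwa [add_zero, Int.cast_neg, ← sub_eq_add_neg] at this
  rw [hχ x _ hf.1 (Int.fract_nonneg r) (Int.fract_lt_one r) hf.2, Complex.exp_eq_exp_iff_exists_int]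
  refine ⟨-⌊r⌋, ?_⟩
  rw [← Int.self_sub_floor]
  push_cast
  ring

lemma IsStandardChar.map_add (hχ : IsStandardChar χ) (x y : ℚ_[p]) : χ (x + y) = χ x * χ y := by
  obtain ⟨r, hr⟩ := exists_isPolarPart x
  obtain ⟨s, hs⟩ := exists_isPolarPart y
  rw [hχ.eq_exp hr, hχ.eq_exp hs, hχ.eq_exp (hr.add hs), ← Complex.exp_add]
  push_cast
  ring_nf

lemma IsStandardChar.norm_eq_one (hχ : IsStandardChar χ) (x : ℚ_[p]) : ‖χ x‖ = 1 := by
  obtain ⟨r, hr⟩ := exists_isPolarPart x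
  rw [hχ.eq_exp hr, show 2 * (Real.pi : ℂ) * Complex.I * (r : ℂ)
    = ((2 * Real.pi * r : ℝ) : ℂ) * Complex.I by push_cast; ring]
  exact Complex.norm_exp_ofReal_mul_I _

lemma IsStandardChar.eq_one (hχ : IsStandardChar χ) {x : ℚ_[p]} (hx : ‖x‖ ≤ 1) : χ x = 1 := by
  simpa using hχ.eq_exp (isPolarPart_intCast hx 0)

lemma IsStandardChar.inv_prime_ne_one (hχ : IsStandardChar χ) : χ ((p : ℚ_[p])⁻¹) ≠ 1 := by
  have h : IsPolarPart ((p : ℚ_[p])⁻¹) ((p : ℚ)⁻¹) := ⟨⟨1, 1, by simp⟩, by simp⟩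
  rw [hχ.eq_exp h, Ne, Complex.exp_eq_one_iff]
  rintro ⟨n, hn⟩
  have hp0 : (p : ℂ) ≠ 0 := by exact_mod_cast (Fact.out : p.Prime).ne_zero
  have h2 : (2 * Real.pi * Complex.I : ℂ) ≠ 0 := Complex.two_pi_I_ne_zero
  rw [mul_comm (n : ℂ)] at hn
  have hn := mul_left_cancel₀ h2 hn
  push_cast at hn
  have h1 : (n * p : ℤ) = 1 := by
    have : (n : ℂ) * p = 1 := by rw [← hn, inv_mul_cancel₀ hp0]
    exact_mod_cast this
  have h3 : (p : ℤ) ∣ 1 := ⟨n, by rw [← h1, mul_comm]⟩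
  exact (Fact.out : p.Prime).one_lt.ne' (by exact_mod_cast Int.eq_one_of_dvd_one (by positivity) h3)

lemma IsStandardChar.continuous (hχ : IsStandardChar χ) : Continuous χ := by
  refine continuous_iff_continuousAt.2 fun x => ?_
  refine (continuousAt_const (y := χ x)).congr ?_
  filter_upwards [Metric.closedBall_mem_nhds x one_pos] with y hy
  have : χ (x + (y - x)) = χ x * χ (y - x) := hχ.map_add _ _
  rw [hχ.eq_one (x := y - x) (by rwa [← dist_eq_norm]), mul_one, add_sub_cancel] at this
  exact this.symm

variable [MeasurableSpace ℚ_[p]] [BorelSpace ℚ_[p]] (μ : Measure ℚ_[p]) [μ.IsAddHaarMeasure]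

/-- The Fourier transform of the indicator of `B_r` is `p ^ r` times the indicator of `B_{-r}`. -/
lemma IsStandardChar.setIntegral_padicBall (hχ : IsStandardChar χ) (hμ : μ (padicBall p 0) = 1)
    (r : ℤ) (x : ℚ_[p]) :
    ∫ y in padicBall p r, χ (x * y) ∂μ
      = (((p : ℝ) ^ r * (padicBall p (-r)).indicator (fun _ => (1 : ℝ)) x : ℝ) : ℂ) := by
  have hms : MeasurableSet (padicBall p r) := (isClopen_padicBall r).isOpen.measurableSet
  by_cases hx : x ∈ padicBall p (-r)
  · have h1 : ∀ y ∈ padicBall p r, χ (x * y) = 1 := by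
      intro y hy
      refine hχ.eq_one ?_
      rw [norm_mul]
      calc _ ≤ (p : ℝ) ^ (-r) * (p : ℝ) ^ r := by gcongr <;> assumption
        _ = 1 := by rw [← zpow_add₀ prime_cast_pos.ne']; simp
    rw [setIntegral_congr_fun hms h1, Set.indicator_of_mem hx]
    simp [measureReal_padicBall μ hμ]
  · rw [Set.indicator_of_notMem hx, mul_zero, Complex.ofReal_zero]
    have hx0 : x ≠ 0 := by
      rintro rfl
      exact hx (by simp [mem_padicBall, (zpow_pos prime_cast_pos r).le])
    rw [mem_padicBall, Padic.norm_le_pow_iff_norm_lt_pow_add_one, not_lt] at hx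
    set v : ℚ_[p] := x⁻¹ * (p : ℚ_[p])⁻¹ with hv
    have hvm : v ∈ padicBall p r := by
      rw [mem_padicBall, hv, norm_mul, norm_inv, norm_inv, Padic.norm_p, inv_inv]
      rw [inv_mul_le_iff₀ (norm_pos_iff.2 hx0)]
      calc (p : ℝ) = (p : ℝ) ^ (-r + 1) * (p : ℝ) ^ r := by
            rw [← zpow_add₀ prime_cast_pos.ne']; simp
        _ ≤ _ := by gcongr
    have hxv : χ (x * v) ≠ 1 := by
      rw [hv, mul_inv_cancel_left₀ hx0]
      exact hχ.inv_prime_ne_one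
    rw [← integral_indicator hms]
    set F : ℚ_[p] → ℂ := (padicBall p r).indicator fun y => χ (x * y)
    have hF : ∀ y, F (y + v) = χ (x * v) * F y := by
      intro y
      by_cases hy : y ∈ padicBall p r
      · simp only [F, Set.indicator_of_mem hy, Set.indicator_of_mem ((add_mem_padicBall_iff hvm).2 hy)]
        rw [mul_add, hχ.map_add, mul_comm]
      · have hy' := mt (add_mem_padicBall_iff hvm).1 hy
        simp only [F, Set.indicator_of_notMem hy, Set.indicator_of_notMem hy', mul_zero]
    have hI := integral_add_right_eq_self (μ := μ) F v
    simp only [hF, integral_const_mul] at hI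
    have : (χ (x * v) - 1) * ∫ y, F y ∂μ = 0 := by rw [sub_mul, hI]; ring
    exact (mul_eq_zero.1 this).resolve_left (sub_ne_zero.2 hxv)

end Character

section HeatKernel

variable {p : ℕ} [Fact p.Prime]

/-- The weight of the ball `B_r` in the layer decomposition of `y ↦ exp (-(s * ‖y‖ ^ b))`. -/
noncomputable def layerWeight (p : ℕ) (s b : ℝ) (r : ℤ) : ℝ :=
  Real.exp (-(s * (p : ℝ) ^ ((r : ℝ) * b))) - Real.exp (-(s * (p : ℝ) ^ (((r : ℝ) + 1) * b)))

lemma layerWeight_pos {s b : ℝ} (hs : 0 < s) (hb : 0 < b) (r : ℤ) : 0 < layerWeight p s b r := by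
  rw [layerWeight, sub_pos, Real.exp_lt_exp, neg_lt_neg_iff]
  exact mul_lt_mul_of_pos_left
    (Real.rpow_lt_rpow_of_exponent_lt one_lt_prime_cast (by nlinarith)) hs

lemma tendsto_prime_rpow_mul_atTop {b : ℝ} (hb : 0 < b) (m : ℤ) :
    Filter.Tendsto (fun n : ℕ => (p : ℝ) ^ (((m : ℝ) + n) * b)) Filter.atTop Filter.atTop := by
  have h1 : Filter.Tendsto (fun n : ℕ => ((p : ℝ) ^ b) ^ n) Filter.atTop Filter.atTop :=
    tendsto_pow_atTop_atTop_of_one_lt (Real.one_lt_rpow one_lt_prime_cast hb)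
  refine (h1.const_mul_atTop (Real.rpow_pos_of_pos (prime_cast_pos (p := p)) (m * b))).congr
    fun n => ?_
  rw [← Real.rpow_natCast, ← Real.rpow_mul prime_cast_pos.le, ← Real.rpow_add prime_cast_pos]
  ring_nf

lemma summable_layerWeight_mul_zpow {s b : ℝ} (hs : 0 < s) (hb : 0 < b) :
    Summable fun r : ℤ => layerWeight p s b r * (p : ℝ) ^ r := by
  have hp := prime_cast_pos (p := p)
  refine Summable.of_nat_of_neg_add_one ?_ ?_
  · have hsum : Summable fun n : ℕ => Real.exp (-(s * (p : ℝ) ^ ((n : ℝ) * b))) * (p : ℝ) ^ n := by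
      refine summable_of_ratio_test_tendsto_lt_one (l := 0) one_pos
        (Filter.Eventually.of_forall fun n => by positivity) ?_
      have h2 : Filter.Tendsto (fun n : ℕ => p * Real.exp (-(s * ((p : ℝ) ^ b - 1) *
          (p : ℝ) ^ (((0 : ℤ) + (n : ℝ)) * b)))) Filter.atTop (nhds (p * 0)) := by
        refine Filter.Tendsto.const_mul _ (Real.tendsto_exp_neg_atTop_nhds_zero.comp ?_)
        refine (tendsto_prime_rpow_mul_atTop hb 0).const_mul_atTop (mul_pos hs ?_)
        exact sub_pos.2 (Real.one_lt_rpow one_lt_prime_cast hb)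
      rw [mul_zero] at h2
      refine h2.congr fun n => ?_
      rw [Real.norm_of_nonneg (by positivity), Real.norm_of_nonneg (by positivity), mul_div_mul_comm,
        ← Real.exp_sub, pow_succ, mul_div_cancel_left₀ _ (pow_pos hp n).ne', mul_comm]
      congr 2
      push_cast
      rw [zero_add, add_mul (n : ℝ), one_mul, Real.rpow_add hp]
      ring
    refine hsum.of_nonneg_of_le (fun n => mul_nonneg (layerWeight_pos hs hb _).le (by positivity))
      fun n => ?_
    rw [zpow_natCast]
    gcongr
    simp only [layerWeight, Int.cast_natCast, sub_le_self_iff]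
    positivity
  · have hg : Summable fun n : ℕ => ((p : ℝ)⁻¹) ^ (n + 1) :=
      (summable_nat_add_iff 1).2 (summable_geometric_of_lt_one (by positivity)
        (inv_lt_one_of_one_lt₀ one_lt_prime_cast))
    refine hg.of_nonneg_of_le (fun n => mul_nonneg (layerWeight_pos hs hb _).le (by positivity))
      fun n => ?_
    rw [inv_pow, ← zpow_natCast, ← zpow_neg]
    push_cast
    refine mul_le_of_le_one_left (by positivity) ?_
    refine (sub_le_self _ (Real.exp_pos _).le).trans (Real.exp_le_one_iff.2 ?_)
    rw [neg_nonpos]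
    positivity

lemma hasSum_layerWeight_indicator {s b : ℝ} (hs : 0 < s) (hb : 0 < b) {y : ℚ_[p]} (hy : y ≠ 0) :
    HasSum (fun r : ℤ => layerWeight p s b r * (padicBall p r).indicator (fun _ => (1 : ℝ)) y)
      (Real.exp (-(s * ‖y‖ ^ b))) := by
  have hp := prime_cast_pos (p := p)
  set m : ℤ := -y.valuation
  have hm : ‖y‖ = (p : ℝ) ^ m := Padic.norm_eq_zpow_neg_valuation hy
  have hmem : ∀ r, y ∈ padicBall p r ↔ m ≤ r := fun r => by
    rw [mem_padicBall, hm, zpow_le_zpow_iff_right₀ one_lt_prime_cast]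
  have hinj : Function.Injective fun n : ℕ => m + (n : ℤ) := fun i j h => by
    simpa using h
  rw [← hinj.hasSum_iff]
  · have hn : ∀ n : ℕ, y ∈ padicBall p (m + n) := fun n => (hmem _).2 (by omega)
    set e : ℕ → ℝ := fun n => Real.exp (-(s * (p : ℝ) ^ (((m : ℝ) + n) * b))) with he
    have hfun : ((fun r : ℤ => layerWeight p s b r *
        (padicBall p r).indicator (fun _ => (1 : ℝ)) y) ∘ fun n : ℕ => m + (n : ℤ))
        = fun n => e n - e (n + 1) := by
      funext n
      simp only [Function.comp_apply, Set.indicator_of_mem (hn n), mul_one, layerWeight, he]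
      push_cast
      rw [add_assoc]
    have hpos : ∀ n : ℕ, 0 ≤ e n - e (n + 1) := fun n => by
      have := (layerWeight_pos (p := p) hs hb (m + n)).le
      simpa only [layerWeight, he, Int.cast_add, Int.cast_natCast, Nat.cast_add, Nat.cast_one,
        add_assoc] using this
    rw [hfun, hasSum_iff_tendsto_nat_of_nonneg hpos]
    have he0 : e 0 = Real.exp (-(s * ‖y‖ ^ b)) := by
      simp only [he]
      rw [hm, ← Real.rpow_intCast, ← Real.rpow_mul hp.le]
      simp
    simp only [Finset.sum_range_sub']
    rw [he0]
    have : Filter.Tendsto e Filter.atTop (nhds 0) :=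
      Real.tendsto_exp_neg_atTop_nhds_zero.comp
        ((tendsto_prime_rpow_mul_atTop hb m).const_mul_atTop hs)
    simpa using this.const_sub (Real.exp (-(s * ‖y‖ ^ b)))
  · intro r hr
    have : ¬ m ≤ r := fun h => hr ⟨(r - m).toNat, by
      show m + ((r - m).toNat : ℤ) = r
      omega⟩
    rw [Set.indicator_of_notMem (mt (hmem r).1 this), mul_zero]

variable [MeasurableSpace ℚ_[p]] [BorelSpace ℚ_[p]] (μ : Measure ℚ_[p]) [μ.IsAddHaarMeasure]

lemma ae_ne_zero : ∀ᵐ y : ℚ_[p] ∂μ, y ≠ 0 := by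
  simp [ae_iff]

variable {χ : ℚ_[p] → ℂ}

/-- The Fourier transform of `y ↦ exp (-(s * ‖y‖ ^ b))`, computed ball by ball. -/
lemma IsStandardChar.hasSum_fourier (hχ : IsStandardChar χ) (hμ : μ (padicBall p 0) = 1)
    {s b : ℝ} (hs : 0 < s) (hb : 0 < b) (x : ℚ_[p]) :
    HasSum (fun r : ℤ => ((layerWeight p s b r * (p : ℝ) ^ r *
        (padicBall p (-r)).indicator (fun _ => (1 : ℝ)) x : ℝ) : ℂ))
      (∫ y, χ (x * y) * (Real.exp (-(s * ‖y‖ ^ b)) : ℂ) ∂μ) := by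
  have hp := prime_cast_pos (p := p)
  have hms : ∀ r, MeasurableSet (padicBall p r) := fun r => (isClopen_padicBall r).isOpen.measurableSet
  have hcont : Continuous fun y => χ (x * y) := hχ.continuous.comp (continuous_const_mul x)
  set F : ℤ → ℚ_[p] → ℂ := fun r => (padicBall p r).indicator
    fun y => (layerWeight p s b r : ℂ) * χ (x * y) with hF
  have hint : ∀ r, Integrable (F r) μ := fun r =>
    ((continuous_const.mul hcont).continuousOn.integrableOn_compact
      (isCompact_padicBall r)).integrable_indicator (hms r)
  have hnorm : ∀ r, ∫ y, ‖F r y‖ ∂μ = layerWeight p s b r * (p : ℝ) ^ r := fun r => by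
    simp only [hF, norm_indicator_eq_indicator_norm, norm_mul, hχ.norm_eq_one, mul_one]
    rw [integral_indicator (hms r)]
    simp [measureReal_padicBall μ hμ, abs_of_pos (layerWeight_pos hs hb r), mul_comm]
  have key := hasSum_integral_of_summable_integral_norm hint
    (by simpa only [hnorm] using summable_layerWeight_mul_zpow hs hb)
  have h1 : (fun r => ∫ y, F r y ∂μ) = fun r : ℤ => ((layerWeight p s b r * (p : ℝ) ^ r *
        (padicBall p (-r)).indicator (fun _ => (1 : ℝ)) x : ℝ) : ℂ) := by
    funext r
    rw [hF, integral_indicator (hms r), integral_const_mul, hχ.setIntegral_padicBall μ hμ, mul_assoc]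
    push_cast
    rfl
  have h2 : ∫ y, ∑' r, F r y ∂μ = ∫ y, χ (x * y) * (Real.exp (-(s * ‖y‖ ^ b)) : ℂ) ∂μ := by
    refine integral_congr_ae ?_
    filter_upwards [ae_ne_zero μ] with y hy
    have h3 := ((Complex.hasSum_ofReal.2 (hasSum_layerWeight_indicator hs hb hy)).mul_left
      (χ (x * y))).tsum_eq
    rw [← h3]
    refine tsum_congr fun r => ?_
    by_cases hr : y ∈ padicBall p r <;> simp [hF, hr, mul_comm]
  rwa [h1, h2] at key

lemma IsStandardChar.rho_eq_integral (hχ : IsStandardChar χ) (hμ : μ (padicBall p 0) = 1)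
    {σ b t : ℝ} (hσ : 0 < σ) (hb : 0 < b) (ht : 0 < t) (x : ℚ_[p]) :
    (rho p σ b t x : ℂ) = ∫ y, χ (x * y) * (Real.exp (-(σ * t * ‖y‖ ^ b)) : ℂ) ∂μ := by
  rw [← (hχ.hasSum_fourier μ hμ (mul_pos hσ ht) hb x).tsum_eq, ← Complex.ofReal_tsum]
  rfl

lemma IsStandardChar.integrable_exp (hχ : IsStandardChar χ) (hμ : μ (padicBall p 0) = 1)
    {s b : ℝ} (hs : 0 < s) (hb : 0 < b) :
    Integrable (fun y : ℚ_[p] => (Real.exp (-(s * ‖y‖ ^ b)) : ℂ)) μ := by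
  have hp := prime_cast_pos (p := p)
  refine Integrable.of_integral_ne_zero ?_
  have h := hχ.hasSum_fourier μ hμ hs hb 0
  simp only [zero_mul, hχ.eq_one (x := 0) (by simp), one_mul] at h
  rw [← h.tsum_eq, ← Complex.ofReal_tsum, Complex.ofReal_ne_zero]
  have h0 : ∀ r, (0 : ℚ_[p]) ∈ padicBall p (-r) := fun r => by
    simpa [mem_padicBall] using (zpow_pos hp r).le
  have hsum := summable_layerWeight_mul_zpow (p := p) hs hb
  simp only [Set.indicator_of_mem (h0 _), mul_one]
  refine (hsum.tsum_pos (fun r => mul_nonneg (layerWeight_pos hs hb r).le (by positivity)) 0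
    (mul_pos (layerWeight_pos hs hb 0) (by positivity))).ne'

end HeatKernel

lemma IsStandardChar.integral_rho_mul_rho {p : ℕ} [Fact p.Prime]
    [MeasurableSpace ℚ_[p]] [BorelSpace ℚ_[p]] (μ : Measure ℚ_[p]) [μ.IsAddHaarMeasure]
    {χ : ℚ_[p] → ℂ} (hχ : IsStandardChar χ) (hμ : μ (padicBall p 0) = 1)
    {σ b t t' : ℝ} (hσ : 0 < σ) (hb : 0 < b) (ht : 0 < t) (ht' : 0 < t') (z : ℚ_[p]) (a : ℤ) :
    ((∫ x in padicBall p a, rho p σ b t x * rho p σ b t' (z - x) ∂μ : ℝ) : ℂ) =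
      (((p : ℝ) ^ a : ℝ) : ℂ) *
        ∫ y, χ (z * y) * (Real.exp (-(σ * t' * ‖y‖ ^ b)) : ℂ) *
          ((∫ w in padicBall p (-a), Real.exp (-(σ * t * ‖y + w‖ ^ b)) ∂μ : ℝ) : ℂ) ∂μ := by
  have hms : ∀ r, MeasurableSet (padicBall p r) :=
    fun r => (isClopen_padicBall r).isOpen.measurableSet
  have hfin : IsFiniteMeasure (μ.restrict (padicBall p a)) :=
    isFiniteMeasure_restrict.2 (isCompact_padicBall a).measure_lt_top.ne
  set f : ℚ_[p] → ℂ := fun y => (Real.exp (-(σ * t * ‖y‖ ^ b)) : ℂ) with hf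
  set g : ℚ_[p] → ℂ := fun y => (Real.exp (-(σ * t' * ‖y‖ ^ b)) : ℂ) with hg
  have hfi : Integrable f μ := hχ.integrable_exp μ hμ (mul_pos hσ ht) hb
  have hgi : Integrable g μ := hχ.integrable_exp μ hμ (mul_pos hσ ht') hb
  have hrho : ∀ x, (rho p σ b t x : ℂ) = ∫ u, χ (x * u) * f u ∂μ :=
    hχ.rho_eq_integral μ hμ hσ hb ht
  have hrho' : ∀ x, (rho p σ b t' x : ℂ) = ∫ u, χ (x * u) * g u ∂μ :=
    hχ.rho_eq_integral μ hμ hσ hb ht'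
  have htwist : ∀ (φ : ℚ_[p] × ℚ_[p] → ℚ_[p]) (F : ℚ_[p] × ℚ_[p] → ℂ), Continuous φ →
      Integrable F ((μ.restrict (padicBall p a)).prod μ) →
      Integrable (fun q => χ (φ q) * F q) ((μ.restrict (padicBall p a)).prod μ) :=
    fun φ F hφ hF => hF.bdd_mul (c := 1) (hχ.continuous.comp hφ).aestronglyMeasurable
      (Filter.Eventually.of_forall fun q => (hχ.norm_eq_one _).le)
  have hrho_int : Integrable (fun x => (rho p σ b t x : ℂ)) (μ.restrict (padicBall p a)) := by
    simp only [hrho]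
    refine (htwist (fun q => q.1 * q.2) _ (by fun_prop)
      ((integrable_const (1 : ℂ)).mul_prod hfi)).integral_prod_left.congr ?_
    exact Filter.Eventually.of_forall fun x => by simp
  have hinner : ∀ y, ∫ x in padicBall p a, χ (-(x * y)) * (rho p σ b t x : ℂ) ∂μ
      = (((p : ℝ) ^ a : ℝ) : ℂ) *
        ((∫ w in padicBall p (-a), Real.exp (-(σ * t * ‖y + w‖ ^ b)) ∂μ : ℝ) : ℂ) := by
    intro y
    have h1 : ∀ x, χ (-(x * y)) * (rho p σ b t x : ℂ) = ∫ u, χ ((u - y) * x) * f u ∂μ := by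
      intro x
      rw [hrho, ← integral_const_mul]
      refine integral_congr_ae (Filter.Eventually.of_forall fun u => ?_)
      simp only
      rw [← mul_assoc, ← hχ.map_add]
      ring_nf
    simp only [h1]
    rw [integral_integral_swap]
    · simp only [integral_mul_const, hχ.setIntegral_padicBall μ hμ]
      rw [← integral_add_right_eq_self _ y, ← integral_complex_ofReal, ← integral_const_mul,
        ← integral_indicator (hms _)]
      refine integral_congr_ae (Filter.Eventually.of_forall fun w => ?_)
      by_cases hw : w ∈ padicBall p (-a) <;> simp [hf, hw, add_comm]
    · refine (htwist (fun q => (q.2 - y) * q.1) _ (by fun_prop)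
        ((integrable_const (1 : ℂ)).mul_prod hfi)).congr ?_
      exact Filter.Eventually.of_forall fun x => by simp [Function.uncurry]
  rw [← integral_complex_ofReal]
  have h2 : ∀ x, ((rho p σ b t x * rho p σ b t' (z - x) : ℝ) : ℂ)
      = ∫ y, χ (z * y) * g y * (χ (-(x * y)) * (rho p σ b t x : ℂ)) ∂μ := by
    intro x
    rw [Complex.ofReal_mul, hrho' (z - x), ← integral_const_mul]
    refine integral_congr_ae (Filter.Eventually.of_forall fun y => ?_)
    simp only
    rw [show (z - x) * y = z * y + -(x * y) by ring, hχ.map_add]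
    ring
  simp only [h2]
  rw [integral_integral_swap]
  · simp only [integral_const_mul, hinner]
    rw [← integral_const_mul]
    refine integral_congr_ae (Filter.Eventually.of_forall fun y => ?_)
    simp only
    ring
  · refine (htwist (fun q => (z - q.1) * q.2) _ (by fun_prop) (hrho_int.mul_prod hgi)).congr ?_
    refine Filter.Eventually.of_forall fun q => ?_
    simp only [Function.uncurry]
    rw [show (z - q.1) * q.2 = z * q.2 + -(q.1 * q.2) by ring, hχ.map_add]
    ring

/-- For all `t, t' > 0`, every `z ∈ ℚ_p` and every integer `a`,
`∫_{B_a} ρ(t,x)·ρ(t',z−x) dμ(x)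
  = p^a · ∫_{ℚ_p} χ(z·y)·exp(−σ t' |y|^b)·(∫_{B_{−a}} exp(−σ t |y+w|^b) dμ(w)) dμ(y)`;
in particular the complex integral on the right-hand side is a real number. -/
theorem exit_prob_statement_13 (p : ℕ) [Fact p.Prime]
    [MeasurableSpace ℚ_[p]] [BorelSpace ℚ_[p]]
    (μ : Measure ℚ_[p]) [μ.IsAddHaarMeasure]
    (hμ : μ {x : ℚ_[p] | ‖x‖ ≤ 1} = 1)
    (σ b : ℝ) (hσ : 0 < σ) (hb : 0 < b)
    (χ : ℚ_[p] → ℂ)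
    (hχ : ∀ (x : ℚ_[p]) (r : ℚ), (∃ (m : ℤ) (k : ℕ), r = (m : ℚ) / (p : ℚ) ^ k) →
      0 ≤ r → r < 1 → ‖x - (r : ℚ_[p])‖ ≤ 1 →
      χ x = Complex.exp (2 * Real.pi * Complex.I * (r : ℂ)))
    (t t' : ℝ) (ht : 0 < t) (ht' : 0 < t') (z : ℚ_[p]) (a : ℤ) :
    ((∫ x in {x : ℚ_[p] | ‖x‖ ≤ (p : ℝ) ^ a},
        rho p σ b t x * rho p σ b t' (z - x) ∂μ : ℝ) : ℂ) =
      (((p : ℝ) ^ a : ℝ) : ℂ) *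
        ∫ y, χ (z * y) * (Real.exp (-(σ * t' * ‖y‖ ^ b)) : ℂ) *
          ((∫ w in {w : ℚ_[p] | ‖w‖ ≤ (p : ℝ) ^ (-a)},
            Real.exp (-(σ * t * ‖y + w‖ ^ b)) ∂μ : ℝ) : ℂ) ∂μ := by
  exact IsStandardChar.integral_rho_mul_rho μ hχ (by simpa [padicBall] using hμ) hσ hb ht ht' z a
end

section
/- For all t > 0, t' > 0, every integer a, and every z in ℚ_p with |z| ≤ p^a, the strict inequality ∫_{B_a} ρ(t,x)·ρ(t', z−x) dμ(x) > ρ(t+t', z) · ∫_{B_a} ρ(t',x) dμ(x) holds. -/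
open MeasureTheory

namespace PadicDiffusion

variable {p : ℕ} [hp : Fact p.Prime]

/-- The uniform probability density on the ball of radius `p ^ (-r)` around `0`. -/
noncomputable def ballDensity (r : ℤ) (x : ℚ_[p]) : ℝ :=
  (p : ℝ) ^ r * Set.indicator {y : ℚ_[p] | ‖y‖ ≤ (p : ℝ) ^ (-r)} (fun _ => 1) x

/-- The difference of the uniform densities on two consecutive balls. -/
noncomputable def shellWave (r : ℤ) (x : ℚ_[p]) : ℝ :=
  ballDensity r x - ballDensity (r - 1) x

/-- The decay factor `exp (-σ t p ^ (r b))` of the `r`-th shell at time `t`. -/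
noncomputable def decay (p : ℕ) (σ b t : ℝ) (r : ℤ) : ℝ :=
  Real.exp (-(σ * t * (p : ℝ) ^ ((r : ℝ) * b)))

lemma one_lt_cast : (1 : ℝ) < p := by exact_mod_cast hp.out.one_lt

lemma cast_pos : (0 : ℝ) < p := zero_lt_one.trans one_lt_cast

lemma ballDensity_of_le {r : ℤ} {x : ℚ_[p]} (h : ‖x‖ ≤ (p : ℝ) ^ (-r)) :
    ballDensity r x = (p : ℝ) ^ r := by
  rw [ballDensity, Set.indicator_of_mem (by exact h), mul_one]

lemma ballDensity_of_lt {r : ℤ} {x : ℚ_[p]} (h : (p : ℝ) ^ (-r) < ‖x‖) :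
    ballDensity r x = 0 := by
  rw [ballDensity, Set.indicator_of_notMem (by exact not_le.2 h), mul_zero]

lemma ballDensity_nonneg (r : ℤ) (x : ℚ_[p]) : 0 ≤ ballDensity r x := by
  have := zpow_pos (cast_pos (p := p)) r
  rcases le_or_gt ‖x‖ ((p : ℝ) ^ (-r)) with h | h
  · rw [ballDensity_of_le h]; exact this.le
  · rw [ballDensity_of_lt h]

lemma ballDensity_le (r : ℤ) (x : ℚ_[p]) : ballDensity r x ≤ (p : ℝ) ^ r := by
  have := zpow_pos (cast_pos (p := p)) r
  rcases le_or_gt ‖x‖ ((p : ℝ) ^ (-r)) with h | h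
  · rw [ballDensity_of_le h]
  · rw [ballDensity_of_lt h]; exact this.le

lemma ballDensity_neg (r : ℤ) (x : ℚ_[p]) : ballDensity r (-x) = ballDensity r x := by
  simp [ballDensity, Set.indicator]

lemma continuous_ballDensity (r : ℤ) : Continuous (ballDensity (p := p) r) := by
  have h : IsClopen {y : ℚ_[p] | ‖y‖ ≤ (p : ℝ) ^ (-r)} := by
    have := IsUltrametricDist.isClopen_closedBall (0 : ℚ_[p])
      (zpow_pos (cast_pos (p := p)) (-r)).ne'
    convert this using 1
    ext; simp
  exact continuous_const.mul (BoundedContinuousFunction.indicator _ h).continuous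

lemma continuous_shellWave (r : ℤ) : Continuous (shellWave (p := p) r) :=
  (continuous_ballDensity r).sub (continuous_ballDensity (r - 1))

lemma shellWave_neg (r : ℤ) (x : ℚ_[p]) : shellWave r (-x) = shellWave r x := by
  simp [shellWave, ballDensity_neg]

lemma shellWave_of_le {r s : ℤ} (hrs : r ≤ s) {x : ℚ_[p]} (h : ‖x‖ ≤ (p : ℝ) ^ (-s)) :
    shellWave r x = (p : ℝ) ^ r - (p : ℝ) ^ (r - 1) := by
  have hmono : ∀ k ≤ s, ‖x‖ ≤ (p : ℝ) ^ (-k) := fun k hk =>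
    h.trans (zpow_le_zpow_right₀ one_lt_cast.le (by lia))
  rw [shellWave, ballDensity_of_le (hmono r hrs), ballDensity_of_le (hmono (r - 1) (by lia))]

lemma norm_shellWave_le (r : ℤ) (x : ℚ_[p]) : ‖shellWave r x‖ ≤ (p : ℝ) ^ r := by
  have h1 := ballDensity_nonneg r x
  have h2 := ballDensity_le r x
  have h3 := ballDensity_nonneg (r - 1) x
  have h4 := ballDensity_le (r - 1) x
  have h5 : (p : ℝ) ^ (r - 1) ≤ (p : ℝ) ^ r :=
    zpow_le_zpow_right₀ one_lt_cast.le (by lia)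
  rw [Real.norm_eq_abs, shellWave, abs_le]
  constructor <;> linarith

omit hp in
lemma decay_pos (σ b t : ℝ) (r : ℤ) : 0 < decay p σ b t r := Real.exp_pos _

omit hp in
lemma decay_add (σ b t t' : ℝ) (r : ℤ) :
    decay p σ b (t + t') r = decay p σ b t r * decay p σ b t' r := by
  rw [decay, decay, decay, ← Real.exp_add]; congr 1; ring

section decay

variable {σ b t : ℝ} (hσ : 0 < σ) (hb : 0 < b) (ht : 0 < t)
include hσ hb ht

lemma decay_strictAnti : StrictAnti (decay p σ b t) := by
  intro r s hrs
  have : (r : ℝ) < s := by exact_mod_cast hrs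
  have hlt : (p : ℝ) ^ ((r : ℝ) * b) < (p : ℝ) ^ ((s : ℝ) * b) :=
    Real.rpow_lt_rpow_of_exponent_lt one_lt_cast (by nlinarith)
  have : 0 < σ * t := mul_pos hσ ht
  exact Real.exp_lt_exp.2 (by nlinarith)

omit hb in
lemma decay_lt_one (r : ℤ) : decay p σ b t r < 1 := by
  have := Real.rpow_pos_of_pos (cast_pos (p := p)) ((r : ℝ) * b)
  rw [decay, Real.exp_lt_one_iff]
  have : 0 < σ * t * (p : ℝ) ^ ((r : ℝ) * b) := by positivity
  linarith

lemma summable_decay_mul_zpow :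
    Summable fun r : ℤ => decay p σ b t r * (p : ℝ) ^ r := by
  have hp1 := one_lt_cast (p := p)
  have hp0 := cast_pos (p := p)
  have hinv : (p : ℝ)⁻¹ < 1 := inv_lt_one_of_one_lt₀ hp1
  have hgeom : Summable fun n : ℕ => ((p : ℝ)⁻¹) ^ n :=
    summable_geometric_of_lt_one (by positivity) hinv
  have hst : 0 < σ * t := mul_pos hσ ht
  refine Summable.of_nat_of_neg ?_ ?_
  · obtain ⟨k, hk⟩ := exists_nat_ge (2 / b)
    have hkb : 2 ≤ k * b := by rwa [div_le_iff₀ hb] at hk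
    refine Summable.of_nonneg_of_le (fun n => by have := decay_pos (p := p) σ b t n; positivity)
      (fun n => ?_) (hgeom.mul_left (k.factorial / (σ * t) ^ k))
    set y : ℝ := σ * t * (p : ℝ) ^ (((n : ℤ) : ℝ) * b) with hy
    have hq : 0 < (p : ℝ) ^ (((n : ℤ) : ℝ) * b) := Real.rpow_pos_of_pos hp0 _
    have hy0 : 0 < y := by positivity
    have hexp : Real.exp (-y) ≤ k.factorial / y ^ k := by
      rw [Real.exp_neg, inv_le_comm₀ (Real.exp_pos _) (by positivity), inv_div]
      exact Real.pow_div_factorial_le_exp y hy0.le k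
    have hpow : ((p : ℝ) ^ n) ^ 2 ≤ ((p : ℝ) ^ (((n : ℤ) : ℝ) * b)) ^ k := by
      rw [← pow_mul, ← Real.rpow_natCast, ← Real.rpow_natCast, ← Real.rpow_mul hp0.le]
      refine Real.rpow_le_rpow_of_exponent_le hp1.le ?_
      push_cast
      have : (0 : ℝ) ≤ n := n.cast_nonneg
      nlinarith
    have hpn : 0 < (p : ℝ) ^ n := by positivity
    calc decay p σ b t n * (p : ℝ) ^ (n : ℤ) ≤ k.factorial / y ^ k * (p : ℝ) ^ n := by
          rw [zpow_natCast]; exact mul_le_mul_of_nonneg_right hexp hpn.le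
      _ = k.factorial / (σ * t) ^ k * ((p : ℝ) ^ n / ((p : ℝ) ^ (((n : ℤ) : ℝ) * b)) ^ k) := by
          rw [hy, mul_pow]; field_simp
      _ ≤ k.factorial / (σ * t) ^ k * ((p : ℝ)⁻¹) ^ n := by
          refine mul_le_mul_of_nonneg_left ?_ (by positivity)
          rw [div_le_iff₀ (by positivity), inv_pow, inv_mul_eq_div, le_div_iff₀ hpn, ← pow_two]
          exact hpow
  · refine Summable.of_nonneg_of_le (fun n => by have := decay_pos (p := p) σ b t (-n); positivity)
      (fun n => ?_) hgeom
    rw [zpow_neg, zpow_natCast, ← inv_pow]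
    exact mul_le_of_le_one_left (by positivity) (decay_lt_one hσ ht _).le

lemma summable_decay_mul_shellWave (x : ℚ_[p]) :
    Summable fun r : ℤ => decay p σ b t r * shellWave r x := by
  refine (summable_decay_mul_zpow (p := p) hσ hb ht).of_norm_bounded fun r => ?_
  rw [norm_mul, Real.norm_of_nonneg (decay_pos σ b t r).le]
  exact mul_le_mul_of_nonneg_left (norm_shellWave_le r x) (decay_pos σ b t r).le

lemma summable_decay_succ_mul_ballDensity (x : ℚ_[p]) :
    Summable fun r : ℤ => decay p σ b t (r + 1) * ballDensity r x := by
  refine (summable_decay_mul_zpow (p := p) hσ hb ht).of_nonneg_of_le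
    (fun r => mul_nonneg (decay_pos σ b t _).le (ballDensity_nonneg r x)) fun r => ?_
  exact mul_le_mul ((decay_strictAnti hσ hb ht).antitone (by lia)) (ballDensity_le r x)
    (ballDensity_nonneg r x) (decay_pos σ b t r).le

omit hσ hb ht in
lemma hasSum_shift_sub {d : ℤ → ℝ} (hd : Summable d) :
    HasSum (fun r => d (r - 1) - d r) 0 := by
  have h := ((Equiv.subRight (1 : ℤ)).hasSum_iff (f := d)).2 hd.hasSum
  simpa using h.sub hd.hasSum

lemma hasSum_rho (x : ℚ_[p]) :
    HasSum (fun r : ℤ => decay p σ b t r * shellWave r x) (rho p σ b t x) := by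
  have hs := summable_decay_mul_shellWave hσ hb ht x
  have h := hs.hasSum.add (hasSum_shift_sub (summable_decay_succ_mul_ballDensity hσ hb ht x))
  rw [add_zero] at h
  have heq : rho p σ b t x = ∑' r : ℤ, decay p σ b t r * shellWave r x := by
    rw [← h.tsum_eq, rho]
    refine tsum_congr fun r => ?_
    simp only [decay, shellWave, ballDensity, sub_add_cancel]
    push_cast
    ring
  rw [heq]
  exact hs.hasSum

lemma rho_neg (x : ℚ_[p]) : rho p σ b t (-x) = rho p σ b t x := by
  have h := hasSum_rho hσ hb ht (-x)
  simp only [shellWave_neg] at h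
  exact h.unique (hasSum_rho hσ hb ht x)

lemma continuous_rho : Continuous (rho p σ b t) := by
  have h : rho p σ b t = fun x => ∑' r : ℤ, decay p σ b t r * shellWave r x :=
    funext fun x => (hasSum_rho hσ hb ht x).tsum_eq.symm
  rw [h]
  refine continuous_tsum (fun r => continuous_const.mul (continuous_shellWave r))
    (summable_decay_mul_zpow (p := p) hσ hb ht) fun r x => ?_
  rw [norm_mul, Real.norm_of_nonneg (decay_pos σ b t r).le]
  exact mul_le_mul_of_nonneg_left (norm_shellWave_le r x) (decay_pos σ b t r).le

end decay

lemma closedBall_eq_biUnion (k : ℤ) :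
    Metric.closedBall (0 : ℚ_[p]) ((p : ℝ) ^ k) =
      ⋃ i ∈ Finset.range p,
        Metric.closedBall ((i : ℚ_[p]) * (p : ℚ_[p]) ^ (-k)) ((p : ℝ) ^ (k - 1)) := by
  have hp0 := cast_pos (p := p)
  have hpQ : (p : ℚ_[p]) ≠ 0 := by exact_mod_cast hp.out.ne_zero
  have hnorm : ∀ m : ℤ, ‖(p : ℚ_[p]) ^ m‖ = (p : ℝ) ^ (-m) := fun m => Padic.norm_p_zpow m
  ext x
  simp only [Set.mem_iUnion, mem_closedBall_iff_norm, sub_zero, Finset.mem_range,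
    exists_prop]
  constructor
  · intro hx
    have hy : ‖x * (p : ℚ_[p]) ^ k‖ ≤ 1 := by
      rw [norm_mul, hnorm, zpow_neg, ← div_eq_mul_inv]
      exact div_le_one_of_le₀ hx (by positivity)
    obtain ⟨n, hn, hmem⟩ := PadicInt.exists_mem_range (⟨x * (p : ℚ_[p]) ^ k, hy⟩ : ℤ_[p])
    refine ⟨n, hn, ?_⟩
    rw [PadicInt.maximalIdeal_eq_span_p, ← pow_one (p : ℤ_[p]),
      ← PadicInt.norm_le_pow_iff_mem_span_pow] at hmem
    have hmem' : ‖x * (p : ℚ_[p]) ^ k - n‖ ≤ (p : ℝ) ^ (-1 : ℤ) := by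
      exact_mod_cast hmem
    have hfac : x - n * (p : ℚ_[p]) ^ (-k) =
        (x * (p : ℚ_[p]) ^ k - n) * (p : ℚ_[p]) ^ (-k) := by
      rw [sub_mul, mul_assoc, ← zpow_add₀ hpQ, add_neg_cancel, zpow_zero, mul_one]
    rw [hfac, norm_mul, hnorm, neg_neg, sub_eq_neg_add k, zpow_add₀ hp0.ne']
    exact mul_le_mul_of_nonneg_right hmem' (by positivity)
  · rintro ⟨n, -, hx⟩
    have h1 : ‖(n : ℚ_[p]) * (p : ℚ_[p]) ^ (-k)‖ ≤ (p : ℝ) ^ k := by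
      rw [norm_mul, hnorm, neg_neg]
      refine mul_le_of_le_one_left (by positivity) ?_
      exact_mod_cast Padic.norm_int_le_one (p := p) n
    have h2 : (p : ℝ) ^ (k - 1) ≤ (p : ℝ) ^ k :=
      zpow_le_zpow_right₀ one_lt_cast.le (by lia)
    rw [← sub_add_cancel x ((n : ℚ_[p]) * (p : ℚ_[p]) ^ (-k))]
    exact (Padic.nonarchimedean _ _).trans (max_le (hx.trans h2) h1)

lemma disjoint_closedBall_of_ne (k : ℤ) {i j : ℕ} (hi : i < p) (hj : j < p) (hij : i ≠ j) :
    Disjoint (Metric.closedBall ((i : ℚ_[p]) * (p : ℚ_[p]) ^ (-k)) ((p : ℝ) ^ (k - 1)))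
      (Metric.closedBall ((j : ℚ_[p]) * (p : ℚ_[p]) ^ (-k)) ((p : ℝ) ^ (k - 1))) := by
  have hp0 := cast_pos (p := p)
  rw [Set.disjoint_left]
  intro x hxi hxj
  rw [mem_closedBall_iff_norm] at hxi hxj
  have h : ‖((i : ℚ_[p]) - j) * (p : ℚ_[p]) ^ (-k)‖ ≤ (p : ℝ) ^ (k - 1) := by
    have := (Padic.nonarchimedean (x - (j : ℚ_[p]) * (p : ℚ_[p]) ^ (-k))
      (-(x - (i : ℚ_[p]) * (p : ℚ_[p]) ^ (-k)))).trans
        (max_le hxj (by rwa [norm_neg]))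
    rwa [show (x - (j : ℚ_[p]) * (p : ℚ_[p]) ^ (-k)) + -(x - (i : ℚ_[p]) * (p : ℚ_[p]) ^ (-k)) =
      ((i : ℚ_[p]) - j) * (p : ℚ_[p]) ^ (-k) by ring] at this
  have hone : ‖((i : ℚ_[p]) - j)‖ = 1 := by
    have hle : ‖(((i : ℤ) - j : ℤ) : ℚ_[p])‖ ≤ 1 := Padic.norm_int_le_one _
    have hnd : ¬ (p : ℤ) ∣ (i : ℤ) - j := by
      intro hd
      have := Int.eq_zero_of_abs_lt_dvd hd (by rw [abs_lt]; constructor <;> lia)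
      lia
    have hge : ¬ ‖(((i : ℤ) - j : ℤ) : ℚ_[p])‖ < 1 := by
      rwa [Padic.norm_intCast_lt_one_iff]
    simpa using le_antisymm hle (not_lt.1 hge)
  rw [norm_mul, hone, one_mul, Padic.norm_p_zpow, neg_neg] at h
  exact absurd h (not_le.2 (zpow_lt_zpow_right₀ one_lt_cast (by lia)))

section measure

variable [MeasurableSpace ℚ_[p]] [BorelSpace ℚ_[p]] (μ : Measure ℚ_[p]) [μ.IsAddHaarMeasure]

lemma measureReal_closedBall_succ (k : ℤ) :
    μ.real (Metric.closedBall (0 : ℚ_[p]) ((p : ℝ) ^ k)) =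
      p * μ.real (Metric.closedBall (0 : ℚ_[p]) ((p : ℝ) ^ (k - 1))) := by
  rw [closedBall_eq_biUnion, measureReal_biUnion_finset (h := fun i _ => measure_closedBall_lt_top.ne)]
  · simp_rw [Measure.real, Measure.addHaar_closedBall_center]
    simp
  · intro i hi j hj hij
    exact disjoint_closedBall_of_ne k (by simpa using hi) (by simpa using hj) hij
  · exact fun i _ => Metric.isClosed_closedBall.measurableSet

variable {μ} (hμ : μ {x : ℚ_[p] | ‖x‖ ≤ 1} = 1)
include hμ

lemma measureReal_closedBall (z : ℚ_[p]) (k : ℤ) :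
    μ.real (Metric.closedBall z ((p : ℝ) ^ k)) = (p : ℝ) ^ k := by
  have hp0 := cast_pos (p := p)
  rw [Measure.real, Measure.addHaar_closedBall_center, ← Measure.real]
  induction k using Int.induction_on with
  | zero =>
    have : Metric.closedBall (0 : ℚ_[p]) ((p : ℝ) ^ (0 : ℤ)) = {x | ‖x‖ ≤ 1} := by ext; simp
    rw [this, Measure.real, hμ]; simp
  | succ n ih =>
    rw [measureReal_closedBall_succ, add_sub_cancel_right, ih, zpow_add_one₀ hp0.ne', mul_comm]
  | pred n ih =>
    rw [measureReal_closedBall_succ] at ih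
    refine mul_left_cancel₀ hp0.ne' (ih.trans ?_)
    rw [zpow_sub_one₀ hp0.ne']
    field_simp

lemma setIntegral_ballDensity (r s : ℤ) (z : ℚ_[p]) :
    ∫ x in Metric.closedBall 0 ((p : ℝ) ^ (-r)), ballDensity s (z - x) ∂μ =
      (p : ℝ) ^ (-r) * ballDensity (min r s) z := by
  have hp0 := cast_pos (p := p)
  have hmono : ∀ {m n : ℤ}, m ≤ n → (p : ℝ) ^ (-n) ≤ (p : ℝ) ^ (-m) := fun h =>
    zpow_le_zpow_right₀ one_lt_cast.le (by lia)
  have key : ∀ {x : ℚ_[p]} {R : ℝ}, ‖x‖ ≤ R → (‖z - x‖ ≤ R ↔ ‖z‖ ≤ R) := by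
    intro x R hx
    constructor <;> intro h
    · rw [← sub_add_cancel z x]
      exact (Padic.nonarchimedean _ _).trans (max_le h hx)
    · rw [sub_eq_add_neg]
      exact (Padic.nonarchimedean _ _).trans (max_le h (by rwa [norm_neg]))
  rcases le_total s r with hsr | hrs
  · rw [min_eq_right hsr]
    have : ∀ x ∈ Metric.closedBall (0 : ℚ_[p]) ((p : ℝ) ^ (-r)),
        ballDensity s (z - x) = ballDensity s z := by
      intro x hx
      rw [mem_closedBall_zero_iff] at hx
      have := key (hx.trans (hmono hsr))
      simp only [ballDensity, Set.indicator, Set.mem_ofPred_eq, this]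
    rw [setIntegral_congr_fun Metric.isClosed_closedBall.measurableSet this, setIntegral_const,
      measureReal_closedBall hμ, smul_eq_mul]
  · rw [min_eq_left hrs]
    rcases le_or_gt ‖z‖ ((p : ℝ) ^ (-r)) with hz | hz
    · have : (fun x : ℚ_[p] => ballDensity s (z - x)) =
          (Metric.closedBall z ((p : ℝ) ^ (-s))).indicator fun _ => (p : ℝ) ^ s := by
        ext x
        simp [ballDensity, Set.indicator, dist_eq_norm, norm_sub_rev x z]
      have hsub : Metric.closedBall z ((p : ℝ) ^ (-s)) ⊆ Metric.closedBall 0 ((p : ℝ) ^ (-r)) := by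
        intro x hx
        rw [mem_closedBall_iff_norm, norm_sub_rev] at hx
        rw [mem_closedBall_zero_iff]
        have := hx.trans (hmono hrs)
        rw [← sub_sub_cancel z x, sub_eq_add_neg]
        exact (Padic.nonarchimedean _ _).trans (max_le hz (by rwa [norm_neg]))
      rw [this, setIntegral_indicator Metric.isClosed_closedBall.measurableSet,
        Set.inter_eq_right.2 hsub, setIntegral_const, measureReal_closedBall hμ,
        ballDensity_of_le hz, smul_eq_mul, ← zpow_add₀ hp0.ne', ← zpow_add₀ hp0.ne']
      simp
    · have : ∀ x ∈ Metric.closedBall (0 : ℚ_[p]) ((p : ℝ) ^ (-r)),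
          ballDensity s (z - x) = 0 := by
        intro x hx
        rw [mem_closedBall_zero_iff] at hx
        refine ballDensity_of_lt ((hmono hrs).trans_lt (not_le.1 fun h => ?_))
        exact absurd ((key hx).1 h) (not_le.2 hz)
      rw [setIntegral_eq_zero_of_forall_eq_zero this, ballDensity_of_lt hz, mul_zero]

omit hμ in
lemma integrableOn_closedBall {f : ℚ_[p] → ℝ} (hf : Continuous f) (R : ℝ) :
    IntegrableOn f (Metric.closedBall 0 R) μ :=
  hf.continuousOn.integrableOn_compact (isCompact_closedBall 0 R)

lemma setIntegral_shellWave (r s : ℤ) (z : ℚ_[p]) :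
    ∫ x in Metric.closedBall 0 ((p : ℝ) ^ (-r)), shellWave s (z - x) ∂μ =
      if s ≤ r then (p : ℝ) ^ (-r) * shellWave s z else 0 := by
  have hc : ∀ k : ℤ, Continuous fun x : ℚ_[p] => ballDensity k (z - x) := fun k =>
    (continuous_ballDensity k).comp (continuous_const.sub continuous_id)
  simp only [shellWave]
  rw [integral_sub (integrableOn_closedBall (hc s) _) (integrableOn_closedBall (hc (s - 1)) _),
    setIntegral_ballDensity hμ, setIntegral_ballDensity hμ]
  split_ifs with h
  · rw [min_eq_right h, min_eq_right (by lia)]; ring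
  · rw [min_eq_left (by lia), min_eq_left (by lia), sub_self]

omit hμ in
lemma hasSum_setIntegral_closedBall {F : ℤ → ℚ_[p] → ℝ} {C : ℤ → ℝ} (R : ℝ)
    (hF : ∀ r, Continuous (F r)) (hC : Summable C)
    (hFC : ∀ r, ∀ x ∈ Metric.closedBall 0 R, ‖F r x‖ ≤ C r) :
    HasSum (fun r => ∫ x in Metric.closedBall 0 R, F r x ∂μ)
      (∫ x in Metric.closedBall 0 R, ∑' r, F r x ∂μ) := by
  refine hasSum_integral_of_summable_integral_norm
    (fun r => integrableOn_closedBall (hF r) R) ?_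
  refine (hC.mul_right (μ.real (Metric.closedBall 0 R))).of_nonneg_of_le
    (fun r => integral_nonneg fun x => norm_nonneg _) fun r => ?_
  have := norm_setIntegral_le_of_norm_le_const (μ := μ) (f := fun x => ‖F r x‖)
    (s := Metric.closedBall 0 R) (C := C r) measure_closedBall_lt_top
    (fun x hx => by simpa using hFC r x hx)
  exact (le_abs_self _).trans this

variable {σ b : ℝ} (hσ : 0 < σ) (hb : 0 < b)
include hσ hb

lemma hasSum_setIntegral_rho {t : ℝ} (ht : 0 < t) (r : ℤ) (z : ℚ_[p]) :
    HasSum (fun s : ℤ => if s ≤ r then (p : ℝ) ^ (-r) * (decay p σ b t s * shellWave s z) else 0)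
      (∫ x in Metric.closedBall 0 ((p : ℝ) ^ (-r)), rho p σ b t (z - x) ∂μ) := by
  have h := hasSum_setIntegral_closedBall (μ := μ) (p := p) ((p : ℝ) ^ (-r))
    (F := fun s x => decay p σ b t s * shellWave s (z - x))
    (fun s => continuous_const.mul
      ((continuous_shellWave s).comp (continuous_const.sub continuous_id)))
    (summable_decay_mul_zpow (p := p) hσ hb ht) (fun s x _ => by
      rw [norm_mul, Real.norm_of_nonneg (decay_pos σ b t s).le]
      exact mul_le_mul_of_nonneg_left (norm_shellWave_le s _) (decay_pos σ b t s).le)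
  simp_rw [(hasSum_rho hσ hb ht _).tsum_eq, integral_const_mul, setIntegral_shellWave hμ] at h
  convert h using 2 with s
  split_ifs <;> ring

omit [μ.IsAddHaarMeasure] hμ hσ hb in
lemma setIntegral_ballDensity_mul {a r : ℤ} (har : a ≤ r) (g : ℚ_[p] → ℝ) :
    ∫ x in Metric.closedBall 0 ((p : ℝ) ^ (-a)), ballDensity r x * g x ∂μ =
      (p : ℝ) ^ r * ∫ x in Metric.closedBall 0 ((p : ℝ) ^ (-r)), g x ∂μ := by
  have h : (fun x : ℚ_[p] => ballDensity r x * g x) =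
      (Metric.closedBall 0 ((p : ℝ) ^ (-r))).indicator fun x => (p : ℝ) ^ r * g x := by
    ext x
    by_cases hx : ‖x‖ ≤ (p : ℝ) ^ (-r)
    · rw [ballDensity_of_le hx, Set.indicator_of_mem (by simpa using hx)]
    · rw [ballDensity_of_lt (not_le.1 hx), Set.indicator_of_notMem (by simpa using hx), zero_mul]
  rw [h, setIntegral_indicator Metric.isClosed_closedBall.measurableSet, Set.inter_eq_right.2
    (Metric.closedBall_subset_closedBall (zpow_le_zpow_right₀ one_lt_cast.le (by lia))),
    integral_const_mul]

lemma setIntegral_shellWave_mul_rho {t : ℝ} (ht : 0 < t) {a r : ℤ} (har : a < r) (z : ℚ_[p]) :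
    ∫ x in Metric.closedBall 0 ((p : ℝ) ^ (-a)), shellWave r x * rho p σ b t (z - x) ∂μ =
      decay p σ b t r * shellWave r z := by
  have hp0 := cast_pos (p := p)
  have hg : Continuous fun x => rho p σ b t (z - x) :=
    (continuous_rho hσ hb ht).comp (continuous_const.sub continuous_id)
  have hc : ∀ k : ℤ, Continuous fun x => ballDensity k x * rho p σ b t (z - x) := fun k =>
    (continuous_ballDensity k).mul hg
  simp only [shellWave, sub_mul]
  rw [integral_sub (integrableOn_closedBall (hc r) _) (integrableOn_closedBall (hc (r - 1)) _),
    setIntegral_ballDensity_mul har.le, setIntegral_ballDensity_mul (by lia)]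
  have h := ((hasSum_setIntegral_rho hμ hσ hb ht r z).mul_left ((p : ℝ) ^ r)).sub
    ((hasSum_setIntegral_rho hμ hσ hb ht (r - 1) z).mul_left ((p : ℝ) ^ (r - 1)))
  refine h.unique ((hasSum_ite_eq r (decay p σ b t r * shellWave r z)).congr_fun fun s => ?_)
  have hcancel : ∀ k : ℤ, ∀ y : ℝ, (p : ℝ) ^ k * ((p : ℝ) ^ (-k) * y) = y := fun k y => by
    rw [← mul_assoc, ← zpow_add₀ hp0.ne', add_neg_cancel, zpow_zero, one_mul]
  simp only [mul_ite, mul_zero, hcancel]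
  rcases lt_trichotomy s r with hs | rfl | hs
  · rw [if_pos hs.le, if_pos (by lia), if_neg hs.ne, sub_self]
  · rw [if_pos le_rfl, if_neg (by lia), if_pos rfl, sub_zero]
  · rw [if_neg (by lia), if_neg (by lia), if_neg hs.ne', sub_zero]

end measure

/-- The value of the `s`-th shell wave on the ball of radius `p ^ (-a)` times the volume of that
ball, for `s ≤ a`; zero for `s > a`. -/
noncomputable def shellWeight (p : ℕ) (a s : ℤ) : ℝ :=
  if s ≤ a then (p : ℝ) ^ (-a) * ((p : ℝ) ^ s - (p : ℝ) ^ (s - 1)) else 0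

lemma shellWeight_nonneg (a s : ℤ) : 0 ≤ shellWeight p a s := by
  have hp0 := cast_pos (p := p)
  rw [shellWeight]
  split_ifs
  · have : (p : ℝ) ^ (s - 1) ≤ (p : ℝ) ^ s := zpow_le_zpow_right₀ one_lt_cast.le (by lia)
    exact mul_nonneg (by positivity) (sub_nonneg.2 this)
  · exact le_rfl

lemma shellWeight_self_pos (a : ℤ) : 0 < shellWeight p a a := by
  have hp0 := cast_pos (p := p)
  rw [shellWeight, if_pos le_rfl]
  have : (p : ℝ) ^ (a - 1) < (p : ℝ) ^ a := zpow_lt_zpow_right₀ one_lt_cast (by lia)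
  exact mul_pos (by positivity) (sub_pos.2 this)

lemma hasSum_shellWeight (a : ℤ) : HasSum (shellWeight p a) 1 := by
  have hp0 := cast_pos (p := p)
  have hinv : (p : ℝ)⁻¹ < 1 := inv_lt_one_of_one_lt₀ one_lt_cast
  have hinj : Function.Injective fun n : ℕ => a - (n : ℤ) := fun m n h => by
    simp only at h; lia
  rw [← hinj.hasSum_iff]
  · have h := (hasSum_geometric_of_lt_one (inv_nonneg.2 hp0.le) hinv).mul_left (1 - (p : ℝ)⁻¹)
    rw [mul_inv_cancel₀ (sub_pos.2 hinv).ne'] at h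
    refine h.congr_fun fun n => ?_
    rw [Function.comp_apply, shellWeight, if_pos (by lia), zpow_sub_one₀ hp0.ne',
      zpow_sub₀ hp0.ne', zpow_natCast, zpow_neg, inv_pow]
    field_simp
  · intro s hs
    rw [shellWeight, if_neg]
    exact fun h => hs ⟨(a - s).toNat, by simp only; lia⟩

lemma neg_decay_mul_le_of_hasSum {σ b t : ℝ} (hσ : 0 < σ) (hb : 0 < b) (ht : 0 < t) {a : ℤ}
    {z : ℚ_[p]} (hz : ‖z‖ ≤ (p : ℝ) ^ (-a)) {K : ℝ}
    (hK : HasSum (fun r : ℤ => if a < r then decay p σ b t r * shellWave r z else 0) K) :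
    -(decay p σ b t (a + 1) * (p : ℝ) ^ a) ≤ K := by
  let d : ℤ → ℝ := Set.indicator (Set.Ici a) fun r => decay p σ b t (r + 1) * ballDensity r z
  have hd : Summable d := (summable_decay_succ_mul_ballDensity hσ hb ht z).indicator _
  have h := hK.add (hasSum_shift_sub hd)
  rw [add_zero] at h
  refine hasSum_le (fun r => ?_) (hasSum_ite_eq a (-(decay p σ b t (a + 1) * (p : ℝ) ^ a))) h
  rcases lt_trichotomy r a with hr | rfl | hr
  · simp [d, hr.ne, not_lt.2 hr.le, not_le.2 hr, show ¬ a ≤ r - 1 by lia]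
  · simp [d, ballDensity_of_le hz]
  · simp only [d, Set.indicator, Set.mem_Ici, if_pos hr, if_neg hr.ne', if_pos hr.le,
      if_pos (show a ≤ r - 1 by lia), sub_add_cancel, shellWave]
    have h1 : decay p σ b t (r + 1) ≤ decay p σ b t r :=
      (decay_strictAnti hσ hb ht).antitone (by lia)
    nlinarith [ballDensity_nonneg r z]

section exit

variable [MeasurableSpace ℚ_[p]] [BorelSpace ℚ_[p]] {μ : Measure ℚ_[p]} [μ.IsAddHaarMeasure]
  (hμ : μ {x : ℚ_[p] | ‖x‖ ≤ 1} = 1) {σ b : ℝ} (hσ : 0 < σ) (hb : 0 < b)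
include hμ hσ hb

lemma hasSum_shellWeight_mul_decay {t : ℝ} (ht : 0 < t) {a : ℤ} {z : ℚ_[p]}
    (hz : ‖z‖ ≤ (p : ℝ) ^ (-a)) :
    HasSum (fun s => shellWeight p a s * decay p σ b t s)
      (∫ x in Metric.closedBall 0 ((p : ℝ) ^ (-a)), rho p σ b t (z - x) ∂μ) := by
  convert hasSum_setIntegral_rho hμ hσ hb ht a z using 2 with s
  rw [shellWeight]
  split_ifs with h
  · rw [shellWave_of_le h hz]; ring
  · rw [zero_mul]

lemma hasSum_shellWeight_mul_decay_zero {t : ℝ} (ht : 0 < t) (a : ℤ) :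
    HasSum (fun s => shellWeight p a s * decay p σ b t s)
      (∫ x in Metric.closedBall 0 ((p : ℝ) ^ (-a)), rho p σ b t x ∂μ) := by
  have h := hasSum_shellWeight_mul_decay hμ hσ hb ht (a := a) (z := 0)
    (by rw [norm_zero]; exact zpow_nonneg cast_pos.le _)
  simpa only [zero_sub, rho_neg hσ hb ht] using h

lemma hasSum_setIntegral_rho_mul_rho {t t' : ℝ} (ht : 0 < t) (ht' : 0 < t') {a : ℤ} {z : ℚ_[p]}
    (hz : ‖z‖ ≤ (p : ℝ) ^ (-a)) :
    HasSum (fun r : ℤ => (p : ℝ) ^ a *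
        (∫ x in Metric.closedBall 0 ((p : ℝ) ^ (-a)), rho p σ b t' x ∂μ) *
        (shellWeight p a r * decay p σ b t r) +
        if a < r then decay p σ b (t + t') r * shellWave r z else 0)
      (∫ x in Metric.closedBall 0 ((p : ℝ) ^ (-a)), rho p σ b t x * rho p σ b t' (z - x) ∂μ) := by
  have hp0 := cast_pos (p := p)
  have hg : Continuous fun x => rho p σ b t' (z - x) :=
    (continuous_rho hσ hb ht').comp (continuous_const.sub continuous_id)
  obtain ⟨M, hM⟩ := (isCompact_closedBall (0 : ℚ_[p]) ((p : ℝ) ^ (-a))).exists_bound_of_continuousOn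
    hg.continuousOn
  have hM0 : 0 ≤ M := (norm_nonneg _).trans (hM 0 (by simpa using zpow_nonneg hp0.le _))
  have h := hasSum_setIntegral_closedBall (μ := μ) (p := p) ((p : ℝ) ^ (-a))
    (F := fun r x => decay p σ b t r * shellWave r x * rho p σ b t' (z - x))
    (C := fun r => decay p σ b t r * (p : ℝ) ^ r * M)
    (fun r => (continuous_const.mul (continuous_shellWave r)).mul hg)
    ((summable_decay_mul_zpow (p := p) hσ hb ht).mul_right M) (fun r x hx => by
      rw [norm_mul, norm_mul, Real.norm_of_nonneg (decay_pos σ b t r).le]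
      have := decay_pos (p := p) σ b t r
      exact mul_le_mul (mul_le_mul_of_nonneg_left (norm_shellWave_le r _) this.le) (hM x hx)
        (norm_nonneg _) (by positivity))
  simp_rw [tsum_mul_right, (hasSum_rho hσ hb ht _).tsum_eq, mul_assoc, integral_const_mul] at h
  convert h using 2 with r
  rw [shellWeight]
  rcases le_or_gt r a with hr | hr
  · have hP : ∫ x in Metric.closedBall 0 ((p : ℝ) ^ (-a)), rho p σ b t' x ∂μ =
        ∫ x in Metric.closedBall 0 ((p : ℝ) ^ (-a)), rho p σ b t' (z - x) ∂μ :=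
      (hasSum_shellWeight_mul_decay_zero hμ hσ hb ht' a).unique
        (hasSum_shellWeight_mul_decay hμ hσ hb ht' hz)
    have hconst : ∫ x in Metric.closedBall 0 ((p : ℝ) ^ (-a)),
        shellWave r x * rho p σ b t' (z - x) ∂μ =
        ∫ x in Metric.closedBall 0 ((p : ℝ) ^ (-a)),
          ((p : ℝ) ^ r - (p : ℝ) ^ (r - 1)) * rho p σ b t' (z - x) ∂μ :=
      setIntegral_congr_fun Metric.isClosed_closedBall.measurableSet fun x hx => by
        simp only [shellWave_of_le hr (mem_closedBall_zero_iff.1 hx)]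
    rw [if_pos hr, if_neg (not_lt.2 hr), hconst, integral_const_mul, hP, zpow_neg]
    field_simp
    ring
  · rw [if_neg (not_le.2 hr), if_pos hr, setIntegral_shellWave_mul_rho hμ hσ hb ht' hr, decay_add]
    ring

lemma hasSum_rho_sub_setIntegral {t : ℝ} (ht : 0 < t) {a : ℤ} {z : ℚ_[p]}
    (hz : ‖z‖ ≤ (p : ℝ) ^ (-a)) :
    HasSum (fun r : ℤ => if a < r then decay p σ b t r * shellWave r z else 0)
      (rho p σ b t z -
        (p : ℝ) ^ a * ∫ x in Metric.closedBall 0 ((p : ℝ) ^ (-a)), rho p σ b t x ∂μ) := by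
  have hp0 := cast_pos (p := p)
  refine HasSum.congr_fun ((hasSum_rho hσ hb ht z).sub
    ((hasSum_shellWeight_mul_decay_zero hμ hσ hb ht a).mul_left ((p : ℝ) ^ a)))
    fun r => ?_
  rw [shellWeight]
  rcases le_or_gt r a with hr | hr
  · rw [if_pos hr, if_neg (not_lt.2 hr), shellWave_of_le hr hz, zpow_neg]
    field_simp
    ring
  · rw [if_neg (not_le.2 hr), if_pos hr]
    ring

lemma decay_le_setIntegral_rho {t : ℝ} (ht : 0 < t) (a : ℤ) :
    decay p σ b t a ≤ ∫ x in Metric.closedBall 0 ((p : ℝ) ^ (-a)), rho p σ b t x ∂μ := by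
  have h := (hasSum_shellWeight (p := p) a).mul_right (decay p σ b t a)
  rw [one_mul] at h
  refine hasSum_le (fun s => ?_) h (hasSum_shellWeight_mul_decay_zero hμ hσ hb ht a)
  by_cases hs : s ≤ a
  · exact mul_le_mul_of_nonneg_left ((decay_strictAnti hσ hb ht).antitone hs)
      (shellWeight_nonneg a s)
  · simp [shellWeight, hs]

lemma setIntegral_rho_lt_one {t : ℝ} (ht : 0 < t) (a : ℤ) :
    ∫ x in Metric.closedBall 0 ((p : ℝ) ^ (-a)), rho p σ b t x ∂μ < 1 :=
  hasSum_lt (i := a)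
    (fun s => mul_le_of_le_one_right (shellWeight_nonneg a s) (decay_lt_one hσ ht s).le)
    (mul_lt_of_lt_one_right (shellWeight_self_pos a) (decay_lt_one hσ ht a))
    (hasSum_shellWeight_mul_decay_zero hμ hσ hb ht a) (hasSum_shellWeight a)

lemma decay_mul_one_sub_le {t t' : ℝ} (ht : 0 < t) (ht' : 0 < t') (a : ℤ) :
    decay p σ b t a *
        (1 - ∫ x in Metric.closedBall 0 ((p : ℝ) ^ (-a)), rho p σ b t' x ∂μ) ≤
      (∫ x in Metric.closedBall 0 ((p : ℝ) ^ (-a)), rho p σ b t x ∂μ) -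
        ∫ x in Metric.closedBall 0 ((p : ℝ) ^ (-a)), rho p σ b (t + t') x ∂μ := by
  have h := hasSum_shellWeight_mul_decay_zero hμ hσ hb ht a
  have h' := hasSum_shellWeight_mul_decay_zero hμ hσ hb ht' a
  have h'' := hasSum_shellWeight_mul_decay_zero hμ hσ hb (add_pos ht ht') a
  refine hasSum_le (fun s => ?_) (((hasSum_shellWeight (p := p) a).sub h').mul_left (decay p σ b t a))
    (h.sub h'')
  by_cases hs : s ≤ a
  · have h1 := (decay_strictAnti (p := p) hσ hb ht).antitone hs
    have h2 := mul_nonneg (shellWeight_nonneg (p := p) a s)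
      (sub_nonneg.2 (decay_lt_one (p := p) (b := b) hσ ht' s).le)
    rw [decay_add]
    nlinarith
  · simp [shellWeight, hs]

end exit

end PadicDiffusion

open PadicDiffusion

/-- For all `t, t' > 0`, every integer `a`, and every `z ∈ ℚ_p` with
`|z| ≤ p^a`, `∫_{B_a} ρ(t,x)·ρ(t',z−x) dμ(x) > ρ(t+t',z) · ∫_{B_a} ρ(t',x) dμ(x)`. -/
theorem exit_prob_statement_15 (p : ℕ) [Fact p.Prime]
    [MeasurableSpace ℚ_[p]] [BorelSpace ℚ_[p]]
    (μ : Measure ℚ_[p]) [μ.IsAddHaarMeasure]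
    (hμ : μ {x : ℚ_[p] | ‖x‖ ≤ 1} = 1)
    (σ b : ℝ) (hσ : 0 < σ) (hb : 0 < b)
    (t t' : ℝ) (ht : 0 < t) (ht' : 0 < t') (a : ℤ)
    (z : ℚ_[p]) (hz : ‖z‖ ≤ (p : ℝ) ^ a) :
    ∫ x in {x : ℚ_[p] | ‖x‖ ≤ (p : ℝ) ^ a}, rho p σ b t x * rho p σ b t' (z - x) ∂μ >
      rho p σ b (t + t') z *
        ∫ x in {x : ℚ_[p] | ‖x‖ ≤ (p : ℝ) ^ a}, rho p σ b t' x ∂μ := by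
  obtain ⟨a, rfl⟩ : ∃ c : ℤ, a = -c := ⟨-a, (neg_neg a).symm⟩
  have hball : {x : ℚ_[p] | ‖x‖ ≤ (p : ℝ) ^ (-a)} = Metric.closedBall 0 ((p : ℝ) ^ (-a)) := by
    ext; simp
  have htt : 0 < t + t' := add_pos ht ht'
  rw [hball, gt_iff_lt]
  have hK := hasSum_rho_sub_setIntegral hμ hσ hb htt hz
  have hKle := neg_decay_mul_le_of_hasSum hσ hb htt hz hK
  have hlhs := (hasSum_setIntegral_rho_mul_rho hμ hσ hb ht ht' hz).unique
    (((hasSum_shellWeight_mul_decay_zero hμ hσ hb ht a).mul_left _).add hK)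
  rw [hlhs]
  have h1 := decay_le_setIntegral_rho hμ hσ hb ht' a
  have h2 := setIntegral_rho_lt_one hμ hσ hb ht' a
  have h3 := decay_mul_one_sub_le hμ hσ hb ht ht' a
  have h4 : decay p σ b (t + t') (a + 1) < decay p σ b t a * decay p σ b t' a := by
    rw [← decay_add]
    exact decay_strictAnti hσ hb htt (lt_add_one a)
  have hE := decay_pos (p := p) σ b t a
  have hE' := decay_pos (p := p) σ b t' a
  have hpa : 0 < (p : ℝ) ^ a := zpow_pos cast_pos a
  generalize (∫ x in Metric.closedBall 0 ((p : ℝ) ^ (-a)), rho p σ b t x ∂μ) = P at *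
  generalize (∫ x in Metric.closedBall 0 ((p : ℝ) ^ (-a)), rho p σ b t' x ∂μ) = P' at *
  generalize (∫ x in Metric.closedBall 0 ((p : ℝ) ^ (-a)), rho p σ b (t + t') x ∂μ) = P'' at *
  have hgain : decay p σ b t' a * (decay p σ b t a * (1 - P')) ≤ P' * (P - P'') :=
    mul_le_mul h1 h3 (mul_nonneg hE.le (sub_pos.2 h2).le) (hE'.le.trans h1)
  have hstrict := mul_lt_mul_of_pos_right h4 (sub_pos.2 h2)
  have hscaled : 0 < (p : ℝ) ^ a * (P' * (P - P'') - decay p σ b (t + t') (a + 1) * (1 - P')) :=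
    mul_pos hpa (by linarith)
  have hloss := mul_le_mul_of_nonneg_right hKle (sub_pos.2 h2).le
  nlinarith
end
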